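/- Let d ≥ 1, r ≥ 1 and C₀ > 0, and suppose (A,W) ∈ T(r,C₀), i.e. m̌_{r+1}(x) ≤ C₀ m̌ʳ(x) for all x ∈ ℝ^d. Then there exist δ > 0 (one may take δ = 2^{−r}) and a constant C₁ depending only on C₀ (and r, d, p) such that for all complex-valued u ∈ C_0^∞(ℝ^d), ‖ (m̌ʳ)^δ u ‖² ≤ C₁ ( ‖P_{A,W} u‖² + ‖u‖² ). -/

import Mathlib

open MeasureTheory Real Filter

noncomputable section

/-- `ℝ^d` with the Euclidean structure. -/
abbrev Rd (d : ℕ) := EuclideanSpace ℝ (Fin d)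

/-- Partial derivative `∂_{x_j}` of a complex-valued function. -/
def pdC {d : ℕ} (j : Fin d) (f : Rd d → ℂ) : Rd d → ℂ :=
  fun x => fderiv ℝ f x (EuclideanSpace.single j (1:ℝ))

/-- Partial derivative `∂_{x_j}` of a real-valued function. -/
def pdR {d : ℕ} (j : Fin d) (f : Rd d → ℝ) : Rd d → ℝ :=
  fun x => fderiv ℝ f x (EuclideanSpace.single j (1:ℝ))

/-- Iterated partial derivative in the `j`-th direction. -/
def pdIter {d : ℕ} (j : Fin d) : ℕ → (Rd d → ℝ) → (Rd d → ℝ)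
  | 0, f => f
  | n+1, f => pdR j (pdIter j n f)

/-- Multi-index partial derivative `∂^α`. -/
def pdMulti {d : ℕ} (α : Fin d → ℕ) (f : Rd d → ℝ) : Rd d → ℝ :=
  (List.finRange d).foldr (fun j g => pdIter j (α j) g) f

/-- The finite set of multi-indices `α` with `|α| = q`. -/
def mIdx (d q : ℕ) : Finset (Fin d → ℕ) := Finset.Nat.antidiagonalTuple d q

/-- The magnetic field `B_{jk} = ∂_j A_k - ∂_k A_j`. -/
def magB {d : ℕ} (A : Fin d → Rd d → ℝ) (j k : Fin d) : Rd d → ℝ :=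
  fun x => pdR j (A k) x - pdR k (A j) x

/-- The quantity `m̌_q(x)`. -/
def mq {d p : ℕ} (A : Fin d → Rd d → ℝ) (U : Fin p → Rd d → ℝ) (V : Rd d → ℝ) :
    ℕ → Rd d → ℝ
  | 0, x => ∑ ℓ, |U ℓ x|
  | q+1, x =>
      (∑ ℓ, ∑ α ∈ mIdx d (q+1), |pdMulti α (U ℓ) x|)
      + (∑ jk ∈ Finset.univ.filter (fun jk : Fin d × Fin d => jk.1 < jk.2),
          ∑ α ∈ mIdx d q, |pdMulti α (magB A jk.1 jk.2) x|)
      + ∑ α ∈ mIdx d q, |pdMulti α V x|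

/-- The quantity `m̌ʳ(x) = 1 + ∑_{q=0}^r m̌_q(x)`. -/
def mr {d p : ℕ} (A : Fin d → Rd d → ℝ) (U : Fin p → Rd d → ℝ) (V : Rd d → ℝ)
    (r : ℕ) (x : Rd d) : ℝ :=
  1 + ∑ q ∈ Finset.range (r+1), mq A U V q x

/-- The magnetic derivative `X_j u = (D_{x_j} - A_j) u`, `D_{x_j} = -i ∂_{x_j}`. -/
def Xop {d : ℕ} (A : Fin d → Rd d → ℝ) (j : Fin d) (u : Rd d → ℂ) : Rd d → ℂ :=
  fun x => -Complex.I * pdC j u x - (A j x : ℂ) * u x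

/-- The potential `W = ∑_ℓ U_ℓ² + iV`. -/
def Wfun {d p : ℕ} (U : Fin p → Rd d → ℝ) (V : Rd d → ℝ) (x : Rd d) : ℂ :=
  ((∑ ℓ, (U ℓ x)^2 : ℝ) : ℂ) + (V x : ℝ) * Complex.I

/-- The operator `P_{A,W} u = ∑_j X_j² u + W u` with `W = ∑_ℓ U_ℓ² + iV`. -/
def Pop {d p : ℕ} (A : Fin d → Rd d → ℝ) (U : Fin p → Rd d → ℝ) (V : Rd d → ℝ)
    (u : Rd d → ℂ) : Rd d → ℂ :=
  fun x => (∑ j, Xop A j (Xop A j u) x) + Wfun U V x * u x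

/-- The function `Φ(x,t)`. -/
def Phi {d p : ℕ} (A : Fin d → Rd d → ℝ) (U : Fin p → Rd d → ℝ) (V : Rd d → ℝ)
    (r : ℕ) (x : Rd d) (t : ℝ) : ℝ :=
  (∑ ℓ, ∑ q ∈ Finset.range (r+1), t^(q+1) * ∑ α ∈ mIdx d q, |pdMulti α (U ℓ) x|)
  + (∑ jk ∈ Finset.univ.filter (fun jk : Fin d × Fin d => jk.1 < jk.2),
      ∑ q ∈ Finset.range r, t^(q+2) * ∑ α ∈ mIdx d q, |pdMulti α (magB A jk.1 jk.2) x|)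
  + ∑ q ∈ Finset.range r, t^(q+2) * ∑ α ∈ mIdx d q, |pdMulti α V x|

/-- `R(x,μ) = sup { t ∈ [0,1] : Φ(x,t) ≤ μ }`. -/
def Rfun {d p : ℕ} (A : Fin d → Rd d → ℝ) (U : Fin p → Rd d → ℝ) (V : Rd d → ℝ)
    (r : ℕ) (x : Rd d) (μ : ℝ) : ℝ :=
  sSup {t : ℝ | t ∈ Set.Icc (0:ℝ) 1 ∧ Phi A U V r x t ≤ μ}


/-- Smooth real functions. -/
abbrev Sm {d : ℕ} (f : Rd d → ℝ) : Prop := ContDiff ℝ (⊤ : ℕ∞) f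

lemma sm_pdR {d : ℕ} (j : Fin d) {f : Rd d → ℝ} (hf : Sm f) : Sm (pdR j f) := by
  have h1 : ContDiff ℝ (⊤ : ℕ∞) (fderiv ℝ f) := hf.fderiv_right (by simp)
  exact h1.clm_apply contDiff_const

lemma sm_pdC {d : ℕ} (j : Fin d) {f : Rd d → ℂ} (hf : ContDiff ℝ (⊤ : ℕ∞) f) :
    ContDiff ℝ (⊤ : ℕ∞) (pdC j f) := by
  have h1 : ContDiff ℝ (⊤ : ℕ∞) (fderiv ℝ f) := hf.fderiv_right (by simp)
  exact h1.clm_apply contDiff_const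

lemma sm_pdIter {d : ℕ} (j : Fin d) (n : ℕ) {f : Rd d → ℝ} (hf : Sm f) : Sm (pdIter j n f) := by
  induction n with
  | zero => exact hf
  | succ n ih => exact sm_pdR j ih

/-- The list version of `pdMulti`. -/
def pdL {d : ℕ} (l : List (Fin d)) (α : Fin d → ℕ) (f : Rd d → ℝ) : Rd d → ℝ :=
  l.foldr (fun j g => pdIter j (α j) g) f

lemma sm_pdL {d : ℕ} (l : List (Fin d)) (α : Fin d → ℕ) {f : Rd d → ℝ} (hf : Sm f) :
    Sm (pdL l α f) := by
  induction l with
  | nil => exact hf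
  | cons a l ih => exact sm_pdIter a _ ih

lemma sm_pdMulti {d : ℕ} (α : Fin d → ℕ) {f : Rd d → ℝ} (hf : Sm f) :
    Sm (pdMulti α f) := sm_pdL _ α hf

lemma pdR_comm {d : ℕ} (j k : Fin d) {f : Rd d → ℝ} (hf : Sm f) :
    pdR j (pdR k f) = pdR k (pdR j f) := by
  have key : ∀ (a b : Fin d) x, pdR a (pdR b f) x =
      fderiv ℝ (fderiv ℝ f) x (EuclideanSpace.single a 1) (EuclideanSpace.single b 1) := by
    intro a b x
    have h1 : ContDiff ℝ (⊤ : ℕ∞) (fderiv ℝ f) := hf.fderiv_right (by simp)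
    have h2 : DifferentiableAt ℝ (fderiv ℝ f) x := h1.differentiable (by simp) x
    unfold pdR
    rw [fderiv_clm_apply h2 (differentiableAt_const _)]
    simp
  ext x
  rw [key, key]
  have := (hf.contDiffAt (x := x)).isSymmSndFDerivAt
    (by simpa using WithTop.coe_le_coe.2 (le_top : (2:ℕ∞) ≤ ⊤))
  exact this _ _

lemma pdR_pdIter_comm {d : ℕ} (j k : Fin d) (n : ℕ) {f : Rd d → ℝ} (hf : Sm f) :
    pdR j (pdIter k n f) = pdIter k n (pdR j f) := by
  induction n with
  | zero => rfl
  | succ n ih =>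
    change pdR j (pdR k (pdIter k n f)) = pdR k (pdIter k n (pdR j f))
    rw [pdR_comm j k (sm_pdIter k n hf), ih]

lemma pdR_pdL_comm {d : ℕ} (j : Fin d) (l : List (Fin d)) (α : Fin d → ℕ)
    {f : Rd d → ℝ} (hf : Sm f) : pdR j (pdL l α f) = pdL l α (pdR j f) := by
  induction l with
  | nil => rfl
  | cons a l ih =>
    change pdR j (pdIter a (α a) (pdL l α f)) = pdIter a (α a) (pdL l α (pdR j f))
    rw [pdR_pdIter_comm j a _ (sm_pdL l α hf), ih]

lemma pdL_congr {d : ℕ} (l : List (Fin d)) (α β : Fin d → ℕ) (f : Rd d → ℝ)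
    (h : ∀ a ∈ l, α a = β a) : pdL l α f = pdL l β f := by
  induction l with
  | nil => rfl
  | cons a l ih =>
    change pdIter a (α a) (pdL l α f) = pdIter a (β a) (pdL l β f)
    rw [h a (by simp), ih (fun b hb => h b (by simp [hb]))]

lemma pdR_pdL {d : ℕ} (j : Fin d) (l : List (Fin d)) (hl : l.Nodup) (hj : j ∈ l) (α : Fin d → ℕ)
    {f : Rd d → ℝ} (hf : Sm f) :
    pdR j (pdL l α f) = pdL l (Function.update α j (α j + 1)) f := by
  induction l with
  | nil => simp at hj
  | cons a l ih =>
    change pdR j (pdIter a (α a) (pdL l α f)) =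
      pdIter a (Function.update α j (α j + 1) a) (pdL l (Function.update α j (α j + 1)) f)
    rw [List.nodup_cons] at hl
    by_cases hja : j = a
    · subst hja
      rw [pdL_congr l (Function.update α j (α j + 1)) α f]
      · rw [Function.update_self]; rfl
      · intro b hb
        rw [Function.update_of_ne]
        rintro rfl
        exact hl.1 hb
    · have hj' : j ∈ l := by simpa [hja] using hj
      rw [pdR_pdIter_comm j a _ (sm_pdL l α hf), ih hl.2 hj',
        Function.update_of_ne (Ne.symm hja)]

lemma pdR_pdMulti {d : ℕ} (j : Fin d) (α : Fin d → ℕ) {f : Rd d → ℝ} (hf : Sm f) :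
    pdR j (pdMulti α f) = pdMulti (Function.update α j (α j + 1)) f :=
  pdR_pdL j _ (List.nodup_finRange d) (List.mem_finRange j) α hf

lemma mem_mIdx {d q : ℕ} (α : Fin d → ℕ) : α ∈ mIdx d q ↔ ∑ i, α i = q := by
  simp [mIdx, Finset.Nat.mem_antidiagonalTuple]

lemma update_mem {d q : ℕ} (α : Fin d → ℕ) (j : Fin d) (h : α ∈ mIdx d q) :
    Function.update α j (α j + 1) ∈ mIdx d (q+1) := by
  rw [mem_mIdx] at *
  rw [Finset.sum_update_of_mem (Finset.mem_univ j), ← h,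
    ← Finset.add_sum_erase _ α (Finset.mem_univ j), Finset.sdiff_singleton_eq_erase]
  ring

lemma exists_pred {d q : ℕ} (α : Fin d → ℕ) (h : α ∈ mIdx d (q+1)) :
    ∃ j β, β ∈ mIdx d q ∧ α = Function.update β j (β j + 1) := by
  rw [mem_mIdx] at h
  obtain ⟨j, hj⟩ : ∃ j, α j ≠ 0 := by
    by_contra hc
    push Not at hc
    simp [hc] at h
  refine ⟨j, Function.update α j (α j - 1), ?_, ?_⟩
  · rw [mem_mIdx, Finset.sum_update_of_mem (Finset.mem_univ j)]
    rw [← Finset.add_sum_erase _ α (Finset.mem_univ j)] at h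
    rw [Finset.sdiff_singleton_eq_erase]
    omega
  · simp
    rw [Nat.sub_add_cancel (by omega)]
    try simp

lemma pdMulti_zero {d : ℕ} (f : Rd d → ℝ) : pdMulti (0 : Fin d → ℕ) f = f := by
  change pdL _ _ _ = f
  generalize List.finRange d = l
  induction l with
  | nil => rfl
  | cons a l ih => exact ih

/-- Index type for all the coefficient functions. -/
abbrev Idx (d p : ℕ) :=
  (Fin p × (Fin d → ℕ)) ⊕ (((Fin d × Fin d) × (Fin d → ℕ)) ⊕ (Fin d → ℕ))

/-- The coefficient functions. -/
def fn {d p : ℕ} (A : Fin d → Rd d → ℝ) (U : Fin p → Rd d → ℝ) (V : Rd d → ℝ) :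
    Idx d p → Rd d → ℝ
  | .inl (l, α) => pdMulti α (U l)
  | .inr (.inl (jk, α)) => pdMulti α (magB A jk.1 jk.2)
  | .inr (.inr α) => pdMulti α V

/-- The indices of order `q`. -/
def IS (d p : ℕ) : ℕ → Finset (Idx d p)
  | 0 => ((Finset.univ : Finset (Fin p)) ×ˢ mIdx d 0).disjSum ∅
  | q+1 => ((Finset.univ : Finset (Fin p)) ×ˢ mIdx d (q+1)).disjSum
      (((Finset.univ.filter (fun jk : Fin d × Fin d => jk.1 < jk.2)) ×ˢ mIdx d q).disjSum
        (mIdx d q))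

lemma mIdx_zero (d : ℕ) : mIdx d 0 = {0} := by
  ext α
  rw [mem_mIdx]
  simp [funext_iff]

lemma mq_eq {d p : ℕ} (A : Fin d → Rd d → ℝ) (U : Fin p → Rd d → ℝ) (V : Rd d → ℝ)
    (q : ℕ) (x : Rd d) : mq A U V q x = ∑ i ∈ IS d p q, |fn A U V i x| := by
  cases q with
  | zero =>
    simp only [mq, IS]
    rw [Finset.sum_disjSum, Finset.sum_product]
    simp [mIdx_zero, fn, pdMulti_zero]
  | succ q =>
    simp only [mq, IS]
    rw [Finset.sum_disjSum, Finset.sum_product, Finset.sum_disjSum, Finset.sum_product]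
    simp [fn, add_assoc]

lemma sm_magB {d : ℕ} {A : Fin d → Rd d → ℝ} (hA : ∀ j, Sm (A j)) (j k : Fin d) :
    Sm (magB A j k) := (sm_pdR j (hA k)).sub (sm_pdR k (hA j))

lemma sm_fn {d p : ℕ} {A : Fin d → Rd d → ℝ} {U : Fin p → Rd d → ℝ} {V : Rd d → ℝ}
    (hA : ∀ j, Sm (A j)) (hU : ∀ l, Sm (U l)) (hV : Sm V) (i : Idx d p) : Sm (fn A U V i) := by
  rcases i with ⟨l, α⟩ | ⟨jk, α⟩ | α
  · exact sm_pdMulti α (hU l)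
  · exact sm_pdMulti α (sm_magB hA _ _)
  · exact sm_pdMulti α hV

lemma fn_deriv {d p : ℕ} {A : Fin d → Rd d → ℝ} {U : Fin p → Rd d → ℝ} {V : Rd d → ℝ}
    (hA : ∀ j, Sm (A j)) (hU : ∀ l, Sm (U l)) (hV : Sm V) {q : ℕ} (i : Idx d p)
    (hi : i ∈ IS d p q) (j : Fin d) :
    ∃ i' ∈ IS d p (q+1), pdR j (fn A U V i) = fn A U V i' := by
  rcases i with ⟨l, α⟩ | ⟨jk, α⟩ | α
  · refine ⟨.inl (l, Function.update α j (α j + 1)), ?_, pdR_pdMulti j α (hU l)⟩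
    have : α ∈ mIdx d q := by cases q <;> simpa [IS] using hi
    simpa [IS] using update_mem α j this
  · refine ⟨.inr (.inl (jk, Function.update α j (α j + 1))), ?_,
      pdR_pdMulti j α (sm_magB hA _ _)⟩
    cases q with
    | zero => simp [IS] at hi
    | succ q =>
      simp only [IS, Finset.inr_mem_disjSum, Finset.inl_mem_disjSum, Finset.mem_product] at hi ⊢
      exact ⟨hi.1, update_mem α j hi.2⟩
  · refine ⟨.inr (.inr (Function.update α j (α j + 1))), ?_, pdR_pdMulti j α hV⟩
    cases q with
    | zero => simp [IS] at hi
    | succ q =>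
      simp only [IS, Finset.inr_mem_disjSum] at hi ⊢
      exact update_mem α j hi

lemma fn_pred {d p : ℕ} {A : Fin d → Rd d → ℝ} {U : Fin p → Rd d → ℝ} {V : Rd d → ℝ}
    (hA : ∀ j, Sm (A j)) (hU : ∀ l, Sm (U l)) (hV : Sm V) {q : ℕ} (i : Idx d p)
    (hi : i ∈ IS d p (q+1)) :
    (∃ i' ∈ IS d p q, ∃ j, fn A U V i = pdR j (fn A U V i')) ∨
      (q = 0 ∧ ((∃ j k, fn A U V i = magB A j k) ∨ fn A U V i = V)) := by
  rcases i with ⟨l, α⟩ | ⟨jk, α⟩ | α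
  · left
    have : α ∈ mIdx d (q+1) := by simpa [IS] using hi
    obtain ⟨j, β, hβ, rfl⟩ := exists_pred α this
    exact ⟨.inl (l, β), by cases q <;> simpa [IS] using hβ, j, (pdR_pdMulti j β (hU l)).symm⟩
  · simp only [IS, Finset.inr_mem_disjSum, Finset.inl_mem_disjSum, Finset.mem_product] at hi
    cases q with
    | zero =>
      right
      refine ⟨rfl, Or.inl ⟨jk.1, jk.2, ?_⟩⟩
      have : α = 0 := by simpa [mIdx_zero] using hi.2
      subst this
      exact pdMulti_zero _
    | succ q =>
      left
      obtain ⟨j, β, hβ, rfl⟩ := exists_pred α hi.2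
      refine ⟨.inr (.inl (jk, β)), ?_, j, (pdR_pdMulti j β (sm_magB hA _ _)).symm⟩
      simp only [IS, Finset.inr_mem_disjSum, Finset.inl_mem_disjSum, Finset.mem_product]
      exact ⟨hi.1, hβ⟩
  · simp only [IS, Finset.inr_mem_disjSum] at hi
    cases q with
    | zero =>
      right
      refine ⟨rfl, Or.inr ?_⟩
      have : α = 0 := by simpa [mIdx_zero] using hi
      subst this
      exact pdMulti_zero _
    | succ q =>
      left
      obtain ⟨j, β, hβ, rfl⟩ := exists_pred α hi
      refine ⟨.inr (.inr β), ?_, j, (pdR_pdMulti j β hV).symm⟩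
      simpa only [IS, Finset.inr_mem_disjSum] using hβ

abbrev SmC {d : ℕ} (f : Rd d → ℂ) : Prop := ContDiff ℝ (⊤ : ℕ∞) f

lemma sm_diff {d : ℕ} {f : Rd d → ℝ} (hf : Sm f) (x : Rd d) : DifferentiableAt ℝ f x :=
  hf.differentiable (by simp) x

lemma smC_diff {d : ℕ} {f : Rd d → ℂ} (hf : SmC f) (x : Rd d) : DifferentiableAt ℝ f x :=
  hf.differentiable (by simp) x

lemma smC_Xop {d : ℕ} {A : Fin d → Rd d → ℝ} (hA : ∀ j, Sm (A j)) (j : Fin d) {u : Rd d → ℂ}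
    (hu : SmC u) : SmC (Xop A j u) := by
  have h1 : SmC (fun x => (A j x : ℂ)) := Complex.ofRealCLM.contDiff.comp (hA j)
  exact (contDiff_const.mul (sm_pdC j hu)).sub (h1.mul hu)

lemma pdC_zero {d : ℕ} (j : Fin d) {u : Rd d → ℂ} {x : Rd d} (hx : x ∉ tsupport u) :
    pdC j u x = 0 := by
  unfold pdC
  rw [fderiv_of_notMem_tsupport ℝ hx]; simp

lemma Xop_zero {d : ℕ} (A : Fin d → Rd d → ℝ) (j : Fin d) {u : Rd d → ℂ} {x : Rd d}
    (hx : x ∉ tsupport u) : Xop A j u x = 0 := by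
  unfold Xop
  rw [pdC_zero j hx, image_eq_zero_of_notMem_tsupport hx]; simp

lemma Xop2_zero {d : ℕ} (A : Fin d → Rd d → ℝ) (j k : Fin d) {u : Rd d → ℂ} {x : Rd d}
    (hx : x ∉ tsupport u) : Xop A j (Xop A k u) x = 0 := by
  apply Xop_zero
  intro h
  apply hx
  have : Function.support (Xop A k u) ⊆ tsupport u := by
    intro y hy
    by_contra hc
    exact hy (Xop_zero A k hc)
  exact closure_minimal this (isClosed_tsupport u) h

lemma Pop_zero {d p : ℕ} (A : Fin d → Rd d → ℝ) (U : Fin p → Rd d → ℝ) (V : Rd d → ℝ)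
    {u : Rd d → ℂ} {x : Rd d} (hx : x ∉ tsupport u) : Pop A U V u x = 0 := by
  unfold Pop
  rw [image_eq_zero_of_notMem_tsupport hx]
  simp [Xop2_zero A _ _ hx]

lemma cont_Pop {d p : ℕ} {A : Fin d → Rd d → ℝ} {U : Fin p → Rd d → ℝ} {V : Rd d → ℝ}
    (hA : ∀ j, Sm (A j)) (hU : ∀ l, Sm (U l)) (hV : Sm V) {u : Rd d → ℂ} (hu : SmC u) :
    Continuous (Pop A U V u) := by
  have h1 : ∀ j, Continuous (Xop A j (Xop A j u)) := fun j =>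
    (smC_Xop hA j (smC_Xop hA j hu)).continuous
  have h2 : ∀ l, Continuous (U l) := fun l => (hU l).continuous
  have h3 := hV.continuous
  have h4 := hu.continuous
  unfold Pop Wfun
  fun_prop

lemma integ_of {d : ℕ} {F : Type*} [NormedAddCommGroup F] {u : Rd d → ℂ}
    (hc : HasCompactSupport u) {f : Rd d → F}
    (hf : Continuous f) (h0 : ∀ x, x ∉ tsupport u → f x = 0) : Integrable f :=
  hf.integrable_of_hasCompactSupport (HasCompactSupport.intro hc h0)

lemma int_pdC_zero {d : ℕ} (j : Fin d) {h : Rd d → ℂ} (hh : SmC h) (hc : HasCompactSupport h) :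
    ∫ x, pdC j h x = 0 := by
  have h1 : Integrable (fun x => fderiv ℝ h x (EuclideanSpace.single j (1:ℝ))) := integ_of hc (sm_pdC j hh).continuous (fun x hx => pdC_zero j hx)
  have h2 : Integrable h := hh.continuous.integrable_of_hasCompactSupport hc
  have := integral_mul_fderiv_eq_neg_fderiv_mul_of_integrable (μ := (volume : Measure (Rd d)))
    (f := fun _ => (1 : ℂ)) (g := h) (v := EuclideanSpace.single j (1:ℝ))
    (by simp) (by simpa [pdC, pdR] using h1) (by simpa using h2)
    (fun x _ => differentiableAt_const _) (fun x _ => smC_diff hh x)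
  simpa [pdC] using this

lemma int_pdR_zero {d : ℕ} (j : Fin d) {h : Rd d → ℝ} (hh : Sm h) (hc : HasCompactSupport h) :
    ∫ x, pdR j h x = 0 := by
  have h1 : Integrable (fun x => fderiv ℝ h x (EuclideanSpace.single j (1:ℝ))) := by
    refine (sm_pdR j hh).continuous.integrable_of_hasCompactSupport (HasCompactSupport.intro hc ?_)
    intro x hx
    unfold pdR
    rw [fderiv_of_notMem_tsupport ℝ hx]; simp
  have h2 : Integrable h := hh.continuous.integrable_of_hasCompactSupport hc
  have := integral_mul_fderiv_eq_neg_fderiv_mul_of_integrable (μ := (volume : Measure (Rd d)))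
    (f := fun _ => (1 : ℝ)) (g := h) (v := EuclideanSpace.single j (1:ℝ))
    (by simp) (by simpa [pdC, pdR] using h1) (by simpa using h2)
    (fun x _ => differentiableAt_const _) (fun x _ => sm_diff hh x)
  simpa [pdR] using this

/-- The defect in the integration by parts formula for `X_j`. -/
def Dd {d : ℕ} (A : Fin d → Rd d → ℝ) (φ : Rd d → ℝ) (j : Fin d) (u v : Rd d → ℂ) (x : Rd d) : ℂ :=
  (φ x : ℂ) * (star (u x) * Xop A j v x) - (φ x : ℂ) * (star (Xop A j u x) * v x)
    - Complex.I * ((pdR j φ x : ℝ) : ℂ) * (star (u x) * v x)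

lemma smC_prod {d : ℕ} {φ : Rd d → ℝ} {u v : Rd d → ℂ} (hφ : Sm φ) (hu : SmC u) (hv : SmC v) :
    SmC (fun x => (φ x : ℂ) * (star (u x) * v x)) := by
  have h1 : SmC (fun x => (φ x : ℂ)) := Complex.ofRealCLM.contDiff.comp hφ
  have h2 : SmC (fun x => star (u x)) := Complex.conjCLE.contDiff.comp hu
  exact h1.mul (h2.mul hv)

lemma Dd_eq {d : ℕ} (A : Fin d → Rd d → ℝ) {φ : Rd d → ℝ} (j : Fin d) {u v : Rd d → ℂ}
    (hφ : Sm φ) (hu : SmC u) (hv : SmC v) (x : Rd d) :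
    Dd A φ j u v x = -Complex.I * pdC j (fun x => (φ x : ℂ) * (star (u x) * v x)) x := by
  have h1 : HasFDerivAt (fun x => (φ x : ℂ)) (Complex.ofRealCLM.comp (fderiv ℝ φ x)) x :=
    Complex.ofRealCLM.hasFDerivAt.comp x (sm_diff hφ x).hasFDerivAt
  have h2 : HasFDerivAt (fun x => star (u x))
      ((Complex.conjCLE : ℂ →L[ℝ] ℂ).comp (fderiv ℝ u x)) x :=
    (Complex.conjCLE : ℂ →L[ℝ] ℂ).hasFDerivAt.comp x (smC_diff hu x).hasFDerivAt
  have h3 := h1.mul (h2.mul (smC_diff hv x).hasFDerivAt)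
  unfold Dd
  conv_rhs => unfold pdC
  have h4 : fderiv ℝ (fun x => (φ x : ℂ) * (star (u x) * v x)) x = _ := HasFDerivAt.fderiv h3
  rw [h4]
  simp [Xop, pdC, pdR]
  ring_nf
  try simp only [Complex.I_sq]
  try ring

lemma Dd_zero {d : ℕ} (A : Fin d → Rd d → ℝ) (φ : Rd d → ℝ) (j : Fin d) {u : Rd d → ℂ}
    (v : Rd d → ℂ) {x : Rd d} (hx : x ∉ tsupport u) : Dd A φ j u v x = 0 := by
  unfold Dd
  rw [Xop_zero A j hx, image_eq_zero_of_notMem_tsupport hx]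
  simp

lemma Dd_integrable {d : ℕ} {A : Fin d → Rd d → ℝ} {φ : Rd d → ℝ} (j : Fin d) {u v : Rd d → ℂ}
    (hφ : Sm φ) (hu : SmC u) (hv : SmC v) (hc : HasCompactSupport u) (c : ℂ) :
    Integrable (fun x => (c * Dd A φ j u v x).re) := by
  refine integ_of hc ?_ (fun x hx => by simp [Dd_zero A φ j v hx])
  have : Continuous (Dd A φ j u v) := by
    have : Dd A φ j u v = fun x =>
      -Complex.I * pdC j (fun x => (φ x : ℂ) * (star (u x) * v x)) x := by
      ext x; exact Dd_eq A j hφ hu hv x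
    rw [this]
    exact continuous_const.mul (sm_pdC j (smC_prod hφ hu hv)).continuous
  exact Complex.continuous_re.comp (continuous_const.mul this)

lemma Dd_int {d : ℕ} {A : Fin d → Rd d → ℝ} {φ : Rd d → ℝ} (j : Fin d) {u v : Rd d → ℂ}
    (hφ : Sm φ) (hu : SmC u) (hv : SmC v) (hc : HasCompactSupport u) (c : ℂ) :
    ∫ x, (c * Dd A φ j u v x).re = 0 := by
  have hcs : HasCompactSupport (fun x => (φ x : ℂ) * (star (u x) * v x)) :=
    HasCompactSupport.intro hc (fun x hx => by
      rw [image_eq_zero_of_notMem_tsupport hx]; simp)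
  have hs := smC_prod hφ hu hv
  have hi : Integrable (pdC j (fun x => (φ x : ℂ) * (star (u x) * v x))) :=
    integ_of hcs (sm_pdC j hs).continuous (fun x hx => pdC_zero j hx)
  have e : (fun x => (c * Dd A φ j u v x).re) = fun x => Complex.reCLM
      ((c * -Complex.I) * pdC j (fun x => (φ x : ℂ) * (star (u x) * v x)) x) := by
    ext x
    rw [Dd_eq A j hφ hu hv x, ← mul_assoc]; rfl
  rw [e, Complex.reCLM.integral_comp_comm (hi.const_mul _), integral_const_mul,
    int_pdC_zero j hs hcs]
  simp

lemma sm_nsq {d : ℕ} {u : Rd d → ℂ} (hu : SmC u) : Sm (fun x => ‖u x‖^2) := hu.norm_sq ℝ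

lemma pd_nsq {d : ℕ} (A : Fin d → Rd d → ℝ) (j : Fin d) {u : Rd d → ℂ} (hu : SmC u) (x : Rd d) :
    |pdR j (fun x => ‖u x‖^2) x| ≤ 2 * (‖u x‖ * ‖Xop A j u x‖) := by
  have h := (smC_diff hu x).hasFDerivAt.norm_sq
  have e : pdR j (fun x => ‖u x‖^2) x = 2 * (star (u x) * (Complex.I * Xop A j u x)).re := by
    unfold pdR
    rw [HasFDerivAt.fderiv h]
    simp [Xop, pdC, Complex.inner]
    ring
  rw [e, abs_mul, abs_two]
  gcongr
  refine (Complex.abs_re_le_norm _).trans ?_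
  simp

lemma int_le_of {d : ℕ} {f g z : Rd d → ℝ} (hf : Integrable f) (hg : Integrable g)
    (hz : Integrable z) (hz0 : ∫ x, z x = 0) (h : ∀ x, f x ≤ g x + z x) :
    ∫ x, f x ≤ ∫ x, g x := by
  have h1 := integral_mono hf (hg.add hz) h
  have h2 : ∫ x, (g + z) x = (∫ x, g x) + ∫ x, z x := integral_add hg hz
  rw [h2, hz0, add_zero] at h1
  exact h1

/-- The right-hand side of the estimate. -/
def EE {d p : ℕ} (A : Fin d → Rd d → ℝ) (U : Fin p → Rd d → ℝ) (V : Rd d → ℝ)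
    (u : Rd d → ℂ) : ℝ := (∫ x : Rd d, ‖Pop A U V u x‖^2) + ∫ x : Rd d, ‖u x‖^2

lemma star_mul_self_ofReal (z : ℂ) : star z * z = ((‖z‖^2 : ℝ) : ℂ) := by
  have := Complex.conj_mul' z
  push_cast
  exact this

lemma Pop_pt {d p : ℕ} (A : Fin d → Rd d → ℝ) (U : Fin p → Rd d → ℝ) (V : Rd d → ℝ)
    (u : Rd d → ℂ) (x : Rd d) :
    star (u x) * Pop A U V u x = (∑ j, star (u x) * Xop A j (Xop A j u) x)
      + (((∑ l, (U l x)^2 * ‖u x‖^2) : ℝ) : ℂ) + ((V x * ‖u x‖^2 : ℝ) : ℂ) * Complex.I := by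
  have h := star_mul_self_ofReal (u x)
  unfold Pop Wfun
  rw [mul_add, Finset.mul_sum, ← Finset.sum_mul]
  push_cast at h ⊢
  linear_combination ((∑ l, (U l x : ℂ)^2) + V x * Complex.I) * h

section est
variable {d p : ℕ} {A : Fin d → Rd d → ℝ} {U : Fin p → Rd d → ℝ} {V : Rd d → ℝ}
  {u : Rd d → ℂ}

lemma intX (hA : ∀ j, Sm (A j)) (hu : SmC u) (hc : HasCompactSupport u) (j : Fin d) :
    Integrable (fun x => ‖Xop A j u x‖^2) := by
  refine integ_of hc ?_ (fun x hx => by simp [Xop_zero A j hx])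
  exact ((smC_Xop hA j hu).continuous.norm.pow 2)

lemma intu (hu : SmC u) (hc : HasCompactSupport u) : Integrable (fun x => ‖u x‖^2) := by
  refine integ_of hc ?_ (fun x hx => by simp [image_eq_zero_of_notMem_tsupport hx])
  exact (hu.continuous.norm.pow 2)

lemma intfu (hu : SmC u) (hc : HasCompactSupport u) {f : Rd d → ℝ} (hf : Continuous f) :
    Integrable (fun x => f x * ‖u x‖^2) := by
  refine integ_of hc ?_ (fun x hx => by simp [image_eq_zero_of_notMem_tsupport hx])
  exact hf.mul (hu.continuous.norm.pow 2)

lemma intP (hA : ∀ j, Sm (A j)) (hU : ∀ l, Sm (U l)) (hV : Sm V)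
    (hu : SmC u) (hc : HasCompactSupport u) :
    Integrable (fun x => ‖Pop A U V u x‖^2) := by
  refine integ_of hc ?_ (fun x hx => by simp [Pop_zero A U V hx])
  exact ((cont_Pop hA hU hV hu).norm.pow 2)

lemma EE_nonneg : 0 ≤ EE A U V u :=
  add_nonneg (integral_nonneg fun x => by positivity) (integral_nonneg fun x => by positivity)

lemma u_le_EE : ∫ x, ‖u x‖^2 ≤ EE A U V u :=
  le_add_of_nonneg_left (integral_nonneg fun x => by positivity)

lemma energy (hA : ∀ j, Sm (A j)) (hU : ∀ l, Sm (U l)) (hV : Sm V)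
    (hu : SmC u) (hc : HasCompactSupport u) :
    (∑ j, ∫ x, ‖Xop A j u x‖^2) + (∑ l, ∫ x, (U l x)^2 * ‖u x‖^2) ≤ EE A U V u := by
  have iX := fun j => intX hA hu hc j
  have iU : ∀ l, Integrable (fun x => (U l x)^2 * ‖u x‖^2) :=
    fun l => intfu hu hc ((hU l).continuous.pow 2)
  have iD := fun j => Dd_integrable (A := A) (φ := fun _ => 1) j contDiff_const hu
    (smC_Xop hA j hu) hc (-1)
  have zD := fun j => Dd_int (A := A) (φ := fun _ => 1) j contDiff_const hu
    (smC_Xop hA j hu) hc (-1)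
  unfold EE
  rw [← integral_finsetSum _ (fun j _ => iX j), ← integral_finsetSum _ (fun l _ => iU l),
    ← integral_add (integrable_finsetSum _ (fun j _ => iX j))
      (integrable_finsetSum _ (fun l _ => iU l)),
    ← integral_add (intP hA hU hV hu hc) (intu hu hc)]
  refine int_le_of (z := fun x => ∑ j, ((-1) * Dd A (fun _ => 1) j u (Xop A j u) x).re)
    ((integrable_finsetSum _ (fun j _ => iX j)).add
      (integrable_finsetSum _ (fun l _ => iU l)))
    ((intP hA hU hV hu hc).add (intu hu hc))
    (integrable_finsetSum _ (fun j _ => iD j)) ?_ ?_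
  · rw [integral_finsetSum _ (fun j _ => iD j)]
    exact Finset.sum_eq_zero (fun j _ => zD j)
  · intro x
    have h1 : ∀ j, ((-1) * Dd A (fun _ => 1) j u (Xop A j u) x).re =
        ‖Xop A j u x‖^2 - (star (u x) * Xop A j (Xop A j u) x).re := by
      intro j
      have : pdR j (fun _ : Rd d => (1:ℝ)) x = 0 := by simp [pdR]
      unfold Dd
      rw [this, star_mul_self_ofReal]
      simp [-Complex.ofReal_pow]
      try ring
    simp only [h1, Finset.sum_sub_distrib]
    have h2 := congrArg Complex.re (Pop_pt A U V u x)
    simp only [Complex.add_re, Complex.re_sum, Complex.ofReal_re, Complex.re_ofReal_mul,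
      Complex.I_re, mul_zero, add_zero] at h2
    have h3 : (star (u x) * Pop A U V u x).re ≤ ‖u x‖ * ‖Pop A U V u x‖ := by
      refine (Complex.re_le_norm _).trans ?_
      simp
    nlinarith [sq_nonneg (‖u x‖ - ‖Pop A U V u x‖), sq_nonneg (‖u x‖), sq_nonneg (‖Pop A U V u x‖)]

lemma energyX (hA : ∀ j, Sm (A j)) (hU : ∀ l, Sm (U l)) (hV : Sm V)
    (hu : SmC u) (hc : HasCompactSupport u) (j : Fin d) :
    ∫ x, ‖Xop A j u x‖^2 ≤ EE A U V u := by
  have h := energy (V := V) hA hU hV hu hc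
  have h1 : ∫ x, ‖Xop A j u x‖^2 ≤ ∑ j, ∫ x, ‖Xop A j u x‖^2 :=
    Finset.single_le_sum (f := fun j => ∫ x, ‖Xop A j u x‖^2)
      (fun j _ => integral_nonneg fun x => by positivity) (Finset.mem_univ j)
  have h2 : 0 ≤ ∑ l, ∫ x, (U l x)^2 * ‖u x‖^2 :=
    Finset.sum_nonneg (fun j _ => integral_nonneg fun x => by positivity)
  linarith

lemma energyU (hA : ∀ j, Sm (A j)) (hU : ∀ l, Sm (U l)) (hV : Sm V)
    (hu : SmC u) (hc : HasCompactSupport u) (l : Fin p) :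
    ∫ x, (U l x)^2 * ‖u x‖^2 ≤ EE A U V u := by
  have h := energy (V := V) hA hU hV hu hc
  have h1 : ∫ x, (U l x)^2 * ‖u x‖^2 ≤ ∑ l, ∫ x, (U l x)^2 * ‖u x‖^2 :=
    Finset.single_le_sum (f := fun l => ∫ x, (U l x)^2 * ‖u x‖^2)
      (fun j _ => integral_nonneg fun x => by positivity) (Finset.mem_univ l)
  have h2 : 0 ≤ ∑ j, ∫ x, ‖Xop A j u x‖^2 :=
    Finset.sum_nonneg (fun j _ => integral_nonneg fun x => by positivity)
  linarith

lemma pdR_mul {f g : Rd d → ℝ} (hf : Sm f) (hg : Sm g) (j : Fin d) (x : Rd d) :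
    pdR j (fun x => f x * g x) x = pdR j f x * g x + f x * pdR j g x := by
  have := ((sm_diff hf x).hasFDerivAt.mul (sm_diff hg x).hasFDerivAt).fderiv
  have h : fderiv ℝ (fun x => f x * g x) x = _ := this
  unfold pdR
  rw [h]
  simp
  ring

lemma sm_rpow {G : Rd d → ℝ} (hG : Sm G) (hG1 : ∀ x, 1 ≤ G x) (s : ℝ) :
    Sm (fun x => G x ^ s) :=
  hG.rpow_const_of_ne (fun x => by linarith [hG1 x])

lemma pdR_rpow {G : Rd d → ℝ} (hG : Sm G) (hG1 : ∀ x, 1 ≤ G x) (s : ℝ) (j : Fin d) (x : Rd d) :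
    pdR j (fun x => G x ^ s) x = s * G x ^ (s-1) * pdR j G x := by
  have := ((sm_diff hG x).hasFDerivAt.rpow_const (p := s) (Or.inl (by linarith [hG1 x]))).fderiv
  unfold pdR
  rw [this]
  simp

lemma weight {G f : Rd d → ℝ} (hG : Sm G) (hG1 : ∀ x, 1 ≤ G x) (hf : Sm f) {K s : ℝ} (hK : 1 ≤ K)
    (hs : |s| ≤ 2) (j : Fin d) (x : Rd d) (hGd : |pdR j G x| ≤ K * G x)
    (hfb : |f x| ≤ K * G x) (hfd : |pdR j f x| ≤ K * G x) :
    |G x ^ s * f x| ≤ (2*K^2+K) * G x ^ (s+1) ∧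
    |pdR j (fun x => G x ^ s * f x) x| ≤ (2*K^2+K) * G x ^ (s+1) := by
  have g0 : 0 < G x := by linarith [hG1 x]
  have e1 : G x ^ (s+1) = G x ^ s * G x := by rw [rpow_add g0, rpow_one]
  have e2 : G x ^ s = G x ^ (s-1) * G x := by
    rw [← rpow_add_one g0.ne']; congr 1; ring
  have p0 : 0 < G x ^ s := rpow_pos_of_pos g0 _
  have p1 : 0 < G x ^ (s-1) := rpow_pos_of_pos g0 _
  constructor
  · rw [abs_mul, abs_of_pos p0, e1]
    calc G x ^ s * |f x| ≤ G x ^ s * (K * G x) := by gcongr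
      _ = K * (G x ^ s * G x) := by ring
      _ ≤ _ := by gcongr; nlinarith
  · rw [pdR_mul (sm_rpow hG hG1 s) hf, pdR_rpow hG hG1]
    refine (abs_add_le _ _).trans ?_
    rw [abs_mul, abs_mul, abs_mul, abs_mul, abs_of_pos p0, abs_of_pos p1]
    calc _ ≤ 2 * G x ^ (s-1) * (K * G x) * (K * G x) + G x ^ s * (K * G x) := by gcongr
      _ = _ := by rw [e1, e2]; ring

lemma baseV (hA : ∀ j, Sm (A j)) (hU : ∀ l, Sm (U l)) (hV : Sm V)
    (hu : SmC u) (hc : HasCompactSupport u) {φ : Rd d → ℝ} (hφ : Sm φ) {K : ℝ} (hK : 1 ≤ K)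
    (hb : ∀ x, |φ x| ≤ K) (hd : ∀ j x, |pdR j φ x| ≤ K) :
    ∫ x, (φ x * V x) * ‖u x‖^2 ≤ K * (2 * d + 1) * EE A U V u := by
  have iX := fun j => intX hA hu hc j
  have iu := intu hu hc
  have iP := intP hA hU hV hu hc
  have iD := fun j => Dd_integrable (A := A) (φ := φ) j hφ hu
    (smC_Xop hA j hu) hc Complex.I
  have zD := fun j => Dd_int (A := A) (φ := φ) j hφ hu
    (smC_Xop hA j hu) hc Complex.I
  have iS : Integrable (fun x => ∑ j, (‖u x‖^2 + ‖Xop A j u x‖^2)) :=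
    integrable_finsetSum _ (fun j _ => iu.add (iX j))
  have main : ∫ x, (φ x * V x) * ‖u x‖^2 ≤ ∫ x, (K * ((‖Pop A U V u x‖^2 + ‖u x‖^2)
      + ∑ j, (‖u x‖^2 + ‖Xop A j u x‖^2))) := by
    refine int_le_of (z := fun x => ∑ j, (Complex.I * Dd A φ j u (Xop A j u) x).re)
      (intfu hu hc (hφ.continuous.mul hV.continuous))
      (((iP.add iu).add iS).const_mul K)
      (integrable_finsetSum _ (fun j _ => iD j)) ?_ ?_
    · rw [integral_finsetSum _ (fun j _ => iD j)]
      exact Finset.sum_eq_zero (fun j _ => zD j)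
    · intro x
      have h1 : ∀ j, (Complex.I * Dd A φ j u (Xop A j u) x).re =
          - φ x * (star (u x) * Xop A j (Xop A j u) x).im
            + pdR j φ x * (star (u x) * Xop A j u x).re := by
        intro j
        unfold Dd
        rw [star_mul_self_ofReal]
        simp [-Complex.ofReal_pow]
        ring
      simp only [h1, Finset.sum_add_distrib, ← Finset.mul_sum]
      have h2 := congrArg Complex.im (Pop_pt A U V u x)
      simp only [Complex.add_im, Complex.im_sum, Complex.ofReal_im, Complex.im_ofReal_mul,
        Complex.I_im, mul_one, add_zero] at h2
      have h3 : |(star (u x) * Pop A U V u x).im| ≤ ‖u x‖ * ‖Pop A U V u x‖ := by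
        refine (Complex.abs_im_le_norm _).trans ?_
        simp
      have h4 : φ x * (star (u x) * Pop A U V u x).im ≤ K * (‖u x‖ * ‖Pop A U V u x‖) := by
        refine (le_abs_self _).trans ?_
        rw [abs_mul]
        gcongr
        exact hb x
      have h5 : ∑ j, -(pdR j φ x * (star (u x) * Xop A j u x).re) ≤
          ∑ j, K * (‖u x‖^2 + ‖Xop A j u x‖^2) := by
        refine Finset.sum_le_sum (fun j _ => ?_)
        have : |(star (u x) * Xop A j u x).re| ≤ ‖u x‖ * ‖Xop A j u x‖ := by
          refine (Complex.abs_re_le_norm _).trans ?_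
          simp
        refine (neg_le_abs _).trans ?_
        rw [abs_mul]
        have h6 : |pdR j φ x| * |(star (u x) * Xop A j u x).re| ≤ K * (‖u x‖ * ‖Xop A j u x‖) := by
          gcongr
          exact hd j x
        refine h6.trans ?_
        gcongr
        nlinarith [sq_nonneg (‖u x‖ - ‖Xop A j u x‖), sq_nonneg ‖u x‖, sq_nonneg ‖Xop A j u x‖]
      rw [← Finset.mul_sum, Finset.sum_neg_distrib, Finset.sum_add_distrib] at h5
      have h7 : K * (‖u x‖ * ‖Pop A U V u x‖) ≤ K * (‖Pop A U V u x‖^2 + ‖u x‖^2) := by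
        gcongr
        nlinarith [sq_nonneg (‖u x‖ - ‖Pop A U V u x‖), sq_nonneg ‖u x‖, sq_nonneg ‖Pop A U V u x‖]
      rw [h2] at h4
      linarith
  refine main.trans ?_
  have iuX : ∀ j ∈ Finset.univ, Integrable (fun x => ‖u x‖^2 + ‖Xop A j u x‖^2) :=
    fun j _ => iu.add (iX j)
  have iPu : Integrable (fun x => ‖Pop A U V u x‖^2 + ‖u x‖^2) := iP.add iu
  rw [integral_const_mul, integral_add iPu iS, integral_add iP iu,
    integral_finsetSum _ iuX]
  have h8 : ∑ j : Fin d, ∫ x, (‖u x‖^2 + ‖Xop A j u x‖^2) ≤ ∑ j : Fin d, 2 * EE A U V u := by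
    refine Finset.sum_le_sum (fun j _ => ?_)
    rw [integral_add iu (iX j)]
    linarith [energyX (V := V) hA hU hV hu hc j, u_le_EE (A := A) (U := U) (V := V) (u := u)]
  simp only [Finset.sum_const, Finset.card_univ, Fintype.card_fin, nsmul_eq_mul] at h8
  change K * (EE A U V u + _) ≤ _
  rw [mul_assoc]
  gcongr
  linarith

lemma commX (hA : ∀ j, Sm (A j)) (hu : SmC u) (j k : Fin d) (x : Rd d) :
    Xop A j (Xop A k u) x - Xop A k (Xop A j u) x = Complex.I * (magB A j k x : ℂ) * u x := by
  have key : ∀ a b, pdC a (Xop A b u) x = -Complex.I *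
      fderiv ℝ (fderiv ℝ u) x (EuclideanSpace.single a 1) (EuclideanSpace.single b 1)
      - (pdR a (A b) x : ℂ) * u x - (A b x : ℂ) * pdC a u x := by
    intro a b
    have h1 : ContDiff ℝ (⊤ : ℕ∞) (fderiv ℝ u) := hu.fderiv_right (by simp)
    have h2 : HasFDerivAt (fderiv ℝ u) (fderiv ℝ (fderiv ℝ u) x) x :=
      (h1.differentiable (by simp) x).hasFDerivAt
    have h3 : HasFDerivAt (pdC b u) _ x :=
      h2.clm_apply (hasFDerivAt_const (EuclideanSpace.single b (1:ℝ)) x)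
    have h4 : HasFDerivAt (fun x => (A b x : ℂ)) (Complex.ofRealCLM.comp (fderiv ℝ (A b) x)) x :=
      Complex.ofRealCLM.hasFDerivAt.comp x (sm_diff (hA b) x).hasFDerivAt
    have h5 : HasFDerivAt (Xop A b u) _ x :=
      (h3.const_mul (-Complex.I)).sub (h4.mul (smC_diff hu x).hasFDerivAt)
    unfold pdC
    rw [h5.fderiv]
    simp [pdR]
    ring
  have hs := (hu.contDiffAt (x := x)).isSymmSndFDerivAt
    (by simpa using WithTop.coe_le_coe.2 (le_top : (2:ℕ∞) ≤ ⊤))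
    (EuclideanSpace.single j 1) (EuclideanSpace.single k 1)
  conv_lhs => unfold Xop
  change -Complex.I * pdC j (Xop A k u) x - (A j x : ℂ) * Xop A k u x -
    (-Complex.I * pdC k (Xop A j u) x - (A k x : ℂ) * Xop A j u x) = _
  rw [key, key, hs]
  simp only [Xop, magB]
  push_cast
  ring

lemma baseB (hA : ∀ j, Sm (A j)) (hU : ∀ l, Sm (U l)) (hV : Sm V)
    (hu : SmC u) (hc : HasCompactSupport u) {φ : Rd d → ℝ} (hφ : Sm φ) {K : ℝ} (hK : 1 ≤ K)
    (hb : ∀ x, |φ x| ≤ K) (hd : ∀ j x, |pdR j φ x| ≤ K) (j k : Fin d) :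
    ∫ x, (φ x * magB A j k x) * ‖u x‖^2 ≤ K * 6 * EE A U V u := by
  have iX := fun j => intX hA hu hc j
  have iu := intu hu hc
  have iD1 := Dd_integrable (A := A) (φ := φ) j hφ hu (smC_Xop hA k hu) hc (-Complex.I)
  have iD2 := Dd_integrable (A := A) (φ := φ) k hφ hu (smC_Xop hA j hu) hc (Complex.I)
  have zD1 := Dd_int (A := A) (φ := φ) j hφ hu (smC_Xop hA k hu) hc (-Complex.I)
  have zD2 := Dd_int (A := A) (φ := φ) k hφ hu (smC_Xop hA j hu) hc (Complex.I)
  have main : ∫ x, (φ x * magB A j k x) * ‖u x‖^2 ≤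
      ∫ x, (K * (2 * ‖u x‖^2 + (2 * ‖Xop A j u x‖^2 + 2 * ‖Xop A k u x‖^2))) := by
    refine int_le_of (z := fun x => (-Complex.I * Dd A φ j u (Xop A k u) x).re
        + (Complex.I * Dd A φ k u (Xop A j u) x).re)
      (intfu hu hc (hφ.continuous.mul (sm_magB hA j k).continuous))
      (((iu.const_mul 2).add (((iX j).const_mul 2).add ((iX k).const_mul 2))).const_mul K)
      (iD1.add iD2) ?_ ?_
    · rw [integral_add iD1 iD2, zD1, zD2, add_zero]
    · intro x
      have h1 : (φ x * magB A j k x) * ‖u x‖^2 =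
          (-Complex.I * ((φ x : ℂ) * (star (u x) * Xop A j (Xop A k u) x))
          + Complex.I * ((φ x : ℂ) * (star (u x) * Xop A k (Xop A j u) x))).re := by
        have e : (-Complex.I * ((φ x : ℂ) * (star (u x) * Xop A j (Xop A k u) x))
          + Complex.I * ((φ x : ℂ) * (star (u x) * Xop A k (Xop A j u) x))) =
          (((φ x * magB A j k x) * ‖u x‖^2 : ℝ) : ℂ) := by
          have h := star_mul_self_ofReal (u x)
          have hh := commX hA hu j k x
          push_cast at h ⊢
          linear_combination (-Complex.I * φ x * star (u x)) * hh + (φ x * magB A j k x) * h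
            - (φ x * magB A j k x * star (u x) * u x) * Complex.I_sq
        rw [e, Complex.ofReal_re]
      set a := Xop A j u x with ha
      set b := Xop A k u x with hb'
      have hzz : ((-Complex.I * Dd A φ j u (Xop A k u) x).re
        + (Complex.I * Dd A φ k u (Xop A j u) x).re) = (φ x * magB A j k x) * ‖u x‖^2
          - φ x * (star a * b).im + φ x * (star b * a).im
          - pdR j φ x * (star (u x) * b).re + pdR k φ x * (star (u x) * a).re := by
        rw [h1]
        unfold Dd
        simp only [← ha, ← hb']
        simp
        ring
      rw [hzz]
      have nre : ∀ z w : ℂ, |(star z * w).re| ≤ (‖z‖^2 + ‖w‖^2)/2 := by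
        intro z w
        refine (Complex.abs_re_le_norm _).trans ?_
        simp
        nlinarith [sq_nonneg (‖z‖ - ‖w‖)]
      have nim : ∀ z w : ℂ, |(star z * w).im| ≤ (‖z‖^2 + ‖w‖^2)/2 := by
        intro z w
        refine (Complex.abs_im_le_norm _).trans ?_
        simp
        nlinarith [sq_nonneg (‖z‖ - ‖w‖)]
      have pr : ∀ s t m : ℝ, |s| ≤ K → |t| ≤ m → |s * t| ≤ K * m := by
        intro s t m hs ht
        rw [abs_mul]
        gcongr
      have q1 := abs_le.1 (pr _ _ _ (hb x) (nim a b))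
      have q2 := abs_le.1 (pr _ _ _ (hb x) (nim b a))
      have q3 := abs_le.1 (pr _ _ _ (hd j x) (nre (u x) b))
      have q4 := abs_le.1 (pr _ _ _ (hd k x) (nre (u x) a))
      have r1 : 0 ≤ K * ‖a‖^2 := by positivity
      have r2 : 0 ≤ K * ‖b‖^2 := by positivity
      have r3 : 0 ≤ K * ‖u x‖^2 := by positivity
      linarith [q1.1, q1.2, q2.1, q2.2, q3.1, q3.2, q4.1, q4.2]
  refine main.trans ?_
  have iXX : Integrable (fun x => 2 * ‖Xop A j u x‖^2 + 2 * ‖Xop A k u x‖^2) := ((iX j).const_mul 2).add ((iX k).const_mul 2)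
  rw [integral_const_mul, integral_add (iu.const_mul 2) iXX,
    integral_add ((iX j).const_mul 2) ((iX k).const_mul 2), integral_const_mul,
    integral_const_mul, integral_const_mul, mul_assoc]
  gcongr
  linarith [energyX (V := V) hA hU hV hu hc j, energyX (V := V) hA hU hV hu hc k,
    u_le_EE (A := A) (U := U) (V := V) (u := u)]

lemma step (hA : ∀ j, Sm (A j)) (hU : ∀ l, Sm (U l)) (hV : Sm V)
    (hu : SmC u) (hc : HasCompactSupport u) {G L : Rd d → ℝ} (hG : Sm G) (hG1 : ∀ x, 1 ≤ G x)
    (hL : Sm L) {K s C : ℝ} (hK : 1 ≤ K) (hs0 : 0 < s) (hs1 : s ≤ 1) (j : Fin d)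
    (hGd : ∀ x, |pdR j G x| ≤ K * G x)
    (hfb : ∀ x, |pdR j L x| ≤ K * G x) (hfd : ∀ x, |pdR j (pdR j L) x| ≤ K * G x)
    (hC : ∫ x, (G x ^ (-2 + 2 * s) * (L x)^2) * ‖u x‖^2 ≤ C * EE A U V u) :
    ∫ x, (G x ^ (-2 + s) * (pdR j L x)^2) * ‖u x‖^2 ≤
      ((2*K^2+K) * (2 * C + 2)) * EE A U V u := by
  set M := 2*K^2+K with hM
  have iX := intX hA hu hc j
  have iu := intu hu hc
  have hg := sm_pdR j hL
  set φ : Rd d → ℝ := fun x => G x ^ (-2+s) * pdR j L x with hφd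
  have hφ : Sm φ := (sm_rpow hG hG1 _).mul hg
  have hn := sm_nsq hu
  have hsm : Sm (fun x => (L x * φ x) * ‖u x‖^2) := (hL.mul hφ).mul hn
  have hcs : HasCompactSupport (fun x => (L x * φ x) * ‖u x‖^2) :=
    HasCompactSupport.intro hc (fun x hx => by simp [image_eq_zero_of_notMem_tsupport hx])
  have z := int_pdR_zero j hsm hcs
  have iz : Integrable (fun x => pdR j (fun x => (L x * φ x) * ‖u x‖^2) x) := by
    refine (sm_pdR j hsm).continuous.integrable_of_hasCompactSupport (HasCompactSupport.intro hcs ?_)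
    intro x hx
    unfold pdR
    rw [fderiv_of_notMem_tsupport ℝ hx]; simp
  have iT : Integrable (fun x => (G x ^ (-2 + 2 * s) * (L x)^2) * ‖u x‖^2) :=
    intfu hu hc ((sm_rpow hG hG1 _).continuous.mul (hL.continuous.pow 2))
  have main : ∫ x, (G x ^ (-2 + s) * (pdR j L x)^2) * ‖u x‖^2 ≤
      ∫ x, M * (2 * ((G x ^ (-2 + 2 * s) * (L x)^2) * ‖u x‖^2) + (‖u x‖^2 + ‖Xop A j u x‖^2)) := by
    refine int_le_of (z := fun x => pdR j (fun x => (L x * φ x) * ‖u x‖^2) x)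
      (intfu hu hc ((sm_rpow hG hG1 _).continuous.mul (hg.continuous.pow 2)))
      (((iT.const_mul 2).add (iu.add iX)).const_mul M) iz z ?_
    intro x
    have g0 : 0 < G x := by linarith [hG1 x]
    have e := pdR_mul (hL.mul hφ) hn j x
    have e' := pdR_mul hL hφ j x
    rw [e, e']
    obtain ⟨w1, w2⟩ := weight hG hG1 hg hK (s := -2+s) (by rw [abs_le]; constructor <;> linarith)
      j x (hGd x) (hfb x) (hfd x)
    have w3 := pd_nsq A j hu x
    have e2 : -2 + s + 1 = -1 + s := by ring
    rw [e2] at w1 w2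
    change |φ x| ≤ _ at w1
    change |pdR j φ x| ≤ _ at w2
    set y := G x ^ (-1+s) with hy
    have y0 : 0 < y := rpow_pos_of_pos g0 _
    have e3 : G x ^ (-2 + 2*s) = y^2 := by
      rw [hy, ← rpow_natCast, ← rpow_mul g0.le]; congr 1; push_cast; ring
    rw [e3]
    have M0 : 0 ≤ M := by positivity
    have t1 : |L x * pdR j φ x * ‖u x‖^2| ≤ M * ((y * |L x|) * ‖u x‖^2) := by
      rw [abs_mul, abs_mul, abs_of_nonneg (sq_nonneg ‖u x‖)]
      calc |L x| * |pdR j φ x| * ‖u x‖^2 ≤ |L x| * (M * y) * ‖u x‖^2 := by gcongr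
        _ = _ := by ring
    have t2 : |L x * φ x * pdR j (fun x => ‖u x‖^2) x| ≤
        M * ((y * |L x|) * (2 * (‖u x‖ * ‖Xop A j u x‖))) := by
      rw [abs_mul, abs_mul]
      calc _ ≤ |L x| * (M * y) * (2 * (‖u x‖ * ‖Xop A j u x‖)) := by gcongr
        _ = _ := by ring
    have t3 : (y * |L x|) * ‖u x‖^2 + (y * |L x|) * (2 * (‖u x‖ * ‖Xop A j u x‖)) ≤
        2 * ((y^2 * (L x)^2) * ‖u x‖^2) + (‖u x‖^2 + ‖Xop A j u x‖^2) := by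
      have : y^2 * (L x)^2 = (y * |L x|)^2 := by rw [mul_pow, sq_abs]
      rw [this]
      generalize y * |L x| = a
      nlinarith [sq_nonneg (a * ‖u x‖ - ‖Xop A j u x‖), sq_nonneg (a * ‖u x‖ - ‖u x‖),
        sq_nonneg (a * ‖u x‖), sq_nonneg ‖u x‖]
    have t4 := mul_le_mul_of_nonneg_left t3 M0
    have t5 : G x ^ (-2 + s) * (pdR j L x)^2 = pdR j L x * φ x := by rw [hφd]; ring
    rw [t5]
    have t6 := neg_le_of_abs_le t1
    have t7 := neg_le_of_abs_le t2
    linarith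
  refine main.trans ?_
  have iuX : Integrable (fun x => ‖u x‖^2 + ‖Xop A j u x‖^2) := iu.add iX
  rw [integral_const_mul, integral_add (iT.const_mul 2) iuX, integral_const_mul,
    integral_add iu iX, mul_assoc]
  gcongr
  linarith [energyX (V := V) hA hU hV hu hc j, u_le_EE (A := A) (U := U) (V := V) (u := u)]

end est

/-- All indices of order at most `r`. -/
def TT (d p r : ℕ) : Finset (Σ _ : ℕ, Idx d p) := (Finset.range (r+1)).sigma (IS d p)

lemma mr_eq {d p : ℕ} (A : Fin d → Rd d → ℝ) (U : Fin p → Rd d → ℝ) (V : Rd d → ℝ)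
    (r : ℕ) (x : Rd d) : mr A U V r x = 1 + ∑ t ∈ TT d p r, |fn A U V t.2 x| := by
  unfold mr TT
  rw [Finset.sum_sigma]
  simp [mq_eq]

/-- The smooth weight. -/
def GG {d p : ℕ} (A : Fin d → Rd d → ℝ) (U : Fin p → Rd d → ℝ) (V : Rd d → ℝ)
    (r : ℕ) (x : Rd d) : ℝ := √(1 + ∑ t ∈ TT d p r, (fn A U V t.2 x)^2)

/-- The recursive constants. -/
def cst (d : ℕ) (M : ℝ) : ℕ → ℝ
  | 0 => 1
  | q+1 => M * (2 * cst d M q + 2) + M * (2 * d + 7)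

lemma cst_nonneg (d : ℕ) {M : ℝ} (hM : 0 ≤ M) (q : ℕ) : 0 ≤ cst d M q := by
  induction q with
  | zero => simp [cst]
  | succ q ih => simp only [cst]; positivity

section fin
variable {d p r : ℕ} {A : Fin d → Rd d → ℝ} {U : Fin p → Rd d → ℝ} {V : Rd d → ℝ}
  {u : Rd d → ℂ}

lemma FF_ge (x : Rd d) : 1 ≤ 1 + ∑ t ∈ TT d p r, (fn A U V t.2 x)^2 :=
  le_add_of_nonneg_right (Finset.sum_nonneg fun _ _ => sq_nonneg _)

lemma GG_sq (x : Rd d) : GG A U V r x ^ 2 = 1 + ∑ t ∈ TT d p r, (fn A U V t.2 x)^2 :=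
  Real.sq_sqrt (by linarith [FF_ge (r := r) (A := A) (U := U) (V := V) x])

lemma GG_ge (x : Rd d) : 1 ≤ GG A U V r x := by
  unfold GG
  rw [Real.one_le_sqrt]
  exact FF_ge x

lemma fn_le (x : Rd d) {t : Σ _ : ℕ, Idx d p} (ht : t ∈ TT d p r) :
    |fn A U V t.2 x| ≤ GG A U V r x := by
  apply abs_le_of_sq_le_sq _ (by linarith [GG_ge (r := r) (A := A) (U := U) (V := V) x])
  rw [GG_sq]
  have := Finset.single_le_sum (f := fun t : Σ _ : ℕ, Idx d p => (fn A U V t.2 x)^2)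
    (fun _ _ => sq_nonneg _) ht
  linarith

lemma mr_le (x : Rd d) : mr A U V r x ≤ (1 + (TT d p r).card) * GG A U V r x := by
  rw [mr_eq]
  have h : ∑ t ∈ TT d p r, |fn A U V t.2 x| ≤ ∑ t ∈ TT d p r, GG A U V r x :=
    Finset.sum_le_sum fun t ht => fn_le x ht
  rw [Finset.sum_const, nsmul_eq_mul] at h
  linarith [GG_ge (r := r) (A := A) (U := U) (V := V) x]

lemma mq_nonneg (q : ℕ) (x : Rd d) : 0 ≤ mq A U V q x := by
  rw [mq_eq]; exact Finset.sum_nonneg fun _ _ => abs_nonneg _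

lemma mr_ge (x : Rd d) : 1 ≤ mr A U V r x := by
  unfold mr
  linarith [Finset.sum_nonneg (s := Finset.range (r+1)) fun q _ =>
    mq_nonneg (A := A) (U := U) (V := V) q x]

lemma mq_le {C₀ : ℝ} (hC₀ : 0 < C₀) (h : ∀ x, mq A U V (r+1) x ≤ C₀ * mr A U V r x) {q : ℕ}
    (hq : q ≤ r) (x : Rd d) :
    mq A U V (q+1) x ≤ (1 + C₀) * (1 + (TT d p r).card) * GG A U V r x := by
  have h1 : mq A U V (q+1) x ≤ (1 + C₀) * mr A U V r x := by
    have hm := mr_ge (r := r) (A := A) (U := U) (V := V) x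
    rcases hq.eq_or_lt with rfl | hlt
    · linarith [h x]
    · have : mq A U V (q+1) x ≤ mr A U V r x := by
        unfold mr
        have := Finset.single_le_sum (f := fun q => mq A U V q x) (s := Finset.range (r+1))
          (fun q _ => mq_nonneg q x) (Finset.mem_range.2 (show q+1 < r+1 by omega))
        linarith
      nlinarith
  refine h1.trans ?_
  rw [mul_assoc]
  gcongr
  exact mr_le x

lemma fn_d_le (hA : ∀ j, Sm (A j)) (hU : ∀ l, Sm (U l)) (hV : Sm V)
    {C₀ : ℝ} (hC₀ : 0 < C₀) (h : ∀ x, mq A U V (r+1) x ≤ C₀ * mr A U V r x) {q : ℕ}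
    (hq : q ≤ r) {i : Idx d p} (hi : i ∈ IS d p q) (j : Fin d) (x : Rd d) :
    |pdR j (fn A U V i) x| ≤ (1 + C₀) * (1 + (TT d p r).card) * GG A U V r x := by
  obtain ⟨i', hi', e⟩ := fn_deriv hA hU hV i hi j
  rw [e]
  refine le_trans ?_ (mq_le hC₀ h hq x)
  rw [mq_eq]
  exact Finset.single_le_sum (f := fun i => |fn A U V i x|) (fun _ _ => abs_nonneg _) hi'

lemma sm_FF (hA : ∀ j, Sm (A j)) (hU : ∀ l, Sm (U l)) (hV : Sm V) :
    Sm (fun x => 1 + ∑ t ∈ TT d p r, (fn A U V t.2 x)^2) :=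
  contDiff_const.add (ContDiff.sum fun t _ => (sm_fn hA hU hV t.2).pow 2)

lemma sm_GG (hA : ∀ j, Sm (A j)) (hU : ∀ l, Sm (U l)) (hV : Sm V) :
    Sm (GG A U V r) :=
  (sm_FF hA hU hV).sqrt fun x => by linarith [FF_ge (r := r) (A := A) (U := U) (V := V) x]

lemma GG_d_le (hA : ∀ j, Sm (A j)) (hU : ∀ l, Sm (U l)) (hV : Sm V)
    {C₀ : ℝ} (hC₀ : 0 < C₀) (h : ∀ x, mq A U V (r+1) x ≤ C₀ * mr A U V r x) (j : Fin d) (x : Rd d) :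
    |pdR j (GG A U V r) x| ≤ (TT d p r).card * ((1 + C₀) * (1 + (TT d p r).card)) * GG A U V r x := by
  have g1 := GG_ge (r := r) (A := A) (U := U) (V := V) x
  have hs := sm_GG (r := r) hA hU hV
  have e1 := pdR_mul hs hs j x
  have e2 : (fun x => GG A U V r x * GG A U V r x) =
      fun x => 1 + ∑ t ∈ TT d p r, (fn A U V t.2 x)^2 := by
    ext y; rw [← GG_sq, sq]
  have e3 : pdR j (fun x => 1 + ∑ t ∈ TT d p r, (fn A U V t.2 x)^2) x =
      ∑ t ∈ TT d p r, 2 * (fn A U V t.2 x * pdR j (fn A U V t.2) x) := by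
    have hd : ∀ t ∈ TT d p r, HasFDerivAt (fun x => (fn A U V t.2 x)^2) _ x :=
      fun t _ => ((sm_diff (sm_fn hA hU hV t.2) x).hasFDerivAt).pow 2
    have := ((HasFDerivAt.fun_sum hd).const_add 1).fderiv
    unfold pdR
    rw [this, _root_.sum_apply]
    refine Finset.sum_congr rfl fun t _ => ?_
    simp
    ring
  rw [e2, e3] at e1
  set K₁ := (1 + C₀) * (1 + ((TT d p r).card : ℝ)) with hK₁
  set g := GG A U V r x with hg
  have b : |∑ t ∈ TT d p r, 2 * (fn A U V t.2 x * pdR j (fn A U V t.2) x)| ≤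
      ∑ t ∈ TT d p r, 2 * (g * (K₁ * g)) := by
    refine (Finset.abs_sum_le_sum_abs _ _).trans (Finset.sum_le_sum fun t ht => ?_)
    rw [abs_mul, abs_mul, abs_two]
    have ht' := ht
    simp only [TT, Finset.mem_sigma, Finset.mem_range] at ht'
    have := fn_d_le hA hU hV hC₀ h (by omega) ht'.2 j x
    gcongr
    exact fn_le x ht
  rw [e1, Finset.sum_const, nsmul_eq_mul] at b
  have e4 : pdR j (GG A U V r) x * g + g * pdR j (GG A U V r) x =
    (2 * g) * pdR j (GG A U V r) x := by ring
  rw [e4, abs_mul, abs_of_pos (by linarith : 0 < 2 * g)] at b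
  have : (2 * g) * |pdR j (GG A U V r) x| ≤ (2 * g) * ((TT d p r).card * K₁ * g) := by
    refine b.trans (le_of_eq ?_)
    ring
  exact le_of_mul_le_mul_left this (by linarith)

lemma levels (hd : 1 ≤ d) (hA : ∀ j, Sm (A j)) (hU : ∀ l, Sm (U l)) (hV : Sm V)
    (hu : SmC u) (hc : HasCompactSupport u) {K : ℝ} (hK : 1 ≤ K)
    (hG : ∀ j x, |pdR j (GG A U V r) x| ≤ K * GG A U V r x)
    (hf : ∀ q ≤ r, ∀ i ∈ IS d p q, ∀ j x, |pdR j (fn A U V i) x| ≤ K * GG A U V r x)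
    (q : ℕ) (hq : q ≤ r) (i : Idx d p) (hi : i ∈ IS d p q) :
    ∫ x, (GG A U V r x ^ (-2 + 2 * (1/2:ℝ)^q) * (fn A U V i x)^2) * ‖u x‖^2 ≤
      cst d (2*K^2+K) q * EE A U V u := by
  have hsG := sm_GG (r := r) hA hU hV
  have hG1 : ∀ x, 1 ≤ GG A U V r x := fun x => GG_ge x
  set M := 2*K^2+K with hM
  have M1 : 1 ≤ M := by nlinarith
  have hE := EE_nonneg (A := A) (U := U) (V := V) (u := u)
  induction q generalizing i with
  | zero =>
    rcases i with ⟨l, α⟩ | ⟨jk, α⟩ | α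
    · have : α = 0 := by simpa [IS, mIdx_zero, eq_comm] using hi
      subst this
      have e : fn A U V (.inl (l, 0)) = U l := pdMulti_zero _
      rw [e]
      have := energyU (V := V) hA hU hV hu hc l
      simpa [cst] using this
    · simp [IS] at hi
    · simp [IS] at hi
  | succ q ih =>
    have hc0 := cst_nonneg d (M := M) (by linarith) q
    have n1 : 0 ≤ M * (2 * cst d M q + 2) * EE A U V u := by positivity
    have n2 : 0 ≤ M * (2 * d + 7) * EE A U V u := by positivity
    have hcst : cst d M (q+1) = M * (2 * cst d M q + 2) + M * (2 * d + 7) := rfl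
    have hfi : ∀ x, |fn A U V i x| ≤ K * GG A U V r x := fun x => by
      have h1 := fn_le (A := A) (U := U) (V := V) (r := r) x (t := ⟨q+1, i⟩)
        (by simp only [TT, Finset.mem_sigma, Finset.mem_range]; exact ⟨by omega, hi⟩)
      have h2 := hG1 x
      simp only at h1
      nlinarith
    rcases fn_pred hA hU hV i hi with ⟨i', hi', j, e⟩ | ⟨rfl, hB⟩
    · have h1 := ih (by omega) i' hi'
      have h2 := step hA hU hV hu hc hsG hG1 (sm_fn hA hU hV i') (K := K) (s := (1/2)^q)
        (C := cst d M q) hK (by positivity) (pow_le_one₀ (by norm_num) (by norm_num)) j (hG j)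
        (fun x => hf q (by omega) i' hi' j x)
        (fun x => by rw [← e]; exact hf (q+1) hq i hi j x) h1
      rw [← e] at h2
      have e2 : (-2 + 2 * (1/2:ℝ)^(q+1)) = -2 + (1/2)^q := by rw [pow_succ]; ring
      rw [e2, hcst, add_mul]
      linarith
    · set φ : Rd d → ℝ := fun x => GG A U V r x ^ (-1:ℝ) * fn A U V i x with hφd
      have hφ : Sm φ := (sm_rpow hsG hG1 _).mul (sm_fn hA hU hV i)
      have w := fun j x => weight hsG hG1 (sm_fn hA hU hV i) hK (s := -1) (by norm_num) j x
        (hG j x) (hfi x) (hf (0+1) hq i hi j x)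
      simp only [neg_add_cancel, rpow_zero, mul_one] at w
      have e2 : ∀ x, (GG A U V r x ^ (-2 + 2 * (1/2:ℝ)^(0+1)) * (fn A U V i x)^2) =
          φ x * fn A U V i x := by
        intro x
        have : (-2 + 2 * (1/2:ℝ)^(0+1)) = -1 := by norm_num
        rw [this, hφd]; ring
      simp only [e2]
      rw [hcst, add_mul]
      rcases hB with ⟨j, k, e⟩ | e
      · have h3 := baseB (U := U) (V := V) hA hU hV hu hc hφ M1 (fun x => (w j x).1)
          (fun j x => (w j x).2) j k
        rw [← e] at h3
        have : M * 6 * EE A U V u ≤ M * (2 * d + 7) * EE A U V u := by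
          gcongr
          linarith [(Nat.cast_nonneg d : (0:ℝ) ≤ d)]
        linarith
      · have h3 := baseV (U := U) (V := V) hA hU hV hu hc hφ M1 (fun x => (w ⟨0, hd⟩ x).1)
          (fun j x => (w j x).2)
        have : M * (2 * d + 1) * EE A U V u ≤ M * (2 * d + 7) * EE A U V u := by
          gcongr
          norm_num
        have h4 := h3.trans this
        rw [e]
        linarith

end fin

/-- weighted estimate `‖(m̌ʳ)^δ u‖² ≤ C₁ (‖P_{A,W}u‖² + ‖u‖²)`, with
`δ > 0` and `C₁` depending only on `d, p, r, C₀`. -/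
theorem statement_1 (d p r : ℕ) (hd : 1 ≤ d) (hr : 1 ≤ r) (C₀ : ℝ) (hC₀ : 0 < C₀) :
    ∃ δ : ℝ, 0 < δ ∧ ∃ C₁ > 0,
      ∀ (A : Fin d → Rd d → ℝ) (U : Fin p → Rd d → ℝ) (V : Rd d → ℝ),
        (∀ j, ContDiff ℝ (⊤ : ℕ∞) (A j)) → (∀ ℓ, ContDiff ℝ (⊤ : ℕ∞) (U ℓ)) → ContDiff ℝ (⊤ : ℕ∞) V →
        (∀ x, mq A U V (r+1) x ≤ C₀ * mr A U V r x) →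
        ∀ u : Rd d → ℂ, ContDiff ℝ (⊤ : ℕ∞) u → HasCompactSupport u →
          (∫ x : Rd d, (mr A U V r x) ^ (2*δ) * ‖u x‖^2)
            ≤ C₁ * ((∫ x : Rd d, ‖Pop A U V u x‖^2) + ∫ x : Rd d, ‖u x‖^2) := by
  set N : ℝ := ((TT d p r).card : ℝ) with hN
  have N0 : 0 ≤ N := Nat.cast_nonneg _
  set K : ℝ := (1 + N) * ((1 + C₀) * (1 + N)) with hK
  set M : ℝ := 2 * K^2 + K with hM
  have K1' : 1 ≤ (1 + C₀) * (1 + N) := by nlinarith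
  have K1 : 1 ≤ K := by nlinarith
  have M0 : 0 ≤ M := by positivity
  have hcn : ∀ q, 0 ≤ cst d M q := fun q => cst_nonneg d M0 q
  have S0 : 0 ≤ ∑ t ∈ TT d p r, cst d M t.1 := Finset.sum_nonneg fun t _ => hcn t.1
  set δ : ℝ := (1/2)^r with hδ
  have δ0 : 0 < δ := by positivity
  refine ⟨δ, δ0, (1 + N) ^ (2*δ) * (1 + ∑ t ∈ TT d p r, cst d M t.1), by positivity, ?_⟩
  intro A U V hA hU hV hT u hu hc
  have hG : ∀ j x, |pdR j (GG A U V r) x| ≤ K * GG A U V r x := fun j x => by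
    refine (GG_d_le hA hU hV hC₀ hT j x).trans ?_
    have := GG_ge (r := r) (A := A) (U := U) (V := V) x
    gcongr
    linarith
  have hf : ∀ q ≤ r, ∀ i ∈ IS d p q, ∀ j x, |pdR j (fn A U V i) x| ≤ K * GG A U V r x := by
    intro q hq i hi j x
    refine (fn_d_le hA hU hV hC₀ hT hq hi j x).trans ?_
    have := GG_ge (r := r) (A := A) (U := U) (V := V) x
    gcongr
    rw [← hN]
    nlinarith
  have lev := levels hd hA hU hV hu hc K1 hG hf
  have hsG := sm_GG (r := r) hA hU hV
  have hG1 : ∀ x, 1 ≤ GG A U V r x := fun x => GG_ge x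
  have iu := intu hu hc
  have iL : ∀ t ∈ TT d p r, Integrable (fun x =>
      (GG A U V r x ^ (-2 + 2 * (1/2:ℝ)^t.1) * (fn A U V t.2 x)^2) * ‖u x‖^2) := fun t _ =>
    intfu hu hc ((sm_rpow hsG hG1 _).continuous.mul ((sm_fn hA hU hV t.2).continuous.pow 2))
  change _ ≤ _ * EE A U V u
  have main : (∫ x : Rd d, (mr A U V r x) ^ (2*δ) * ‖u x‖^2) ≤
      ∫ x, (1 + N) ^ (2*δ) * (‖u x‖^2 + ∑ t ∈ TT d p r,
        (GG A U V r x ^ (-2 + 2 * (1/2:ℝ)^t.1) * (fn A U V t.2 x)^2) * ‖u x‖^2) := by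
    refine integral_mono_of_nonneg (Eventually.of_forall fun x => ?_)
      ((iu.add (integrable_finsetSum _ iL)).const_mul _) (Eventually.of_forall fun x => ?_)
    · have := mr_ge (r := r) (A := A) (U := U) (V := V) x
      have : 0 ≤ mr A U V r x := by linarith
      simp only [Pi.zero_apply]
      positivity
    · have m1 := mr_ge (r := r) (A := A) (U := U) (V := V) x
      have g1 := hG1 x
      have g0 : 0 < GG A U V r x := by linarith
      have h1 : mr A U V r x ^ (2*δ) ≤ (1 + N) ^ (2*δ) * GG A U V r x ^ (2*δ) := by
        rw [← mul_rpow (by linarith) g0.le]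
        exact rpow_le_rpow (by linarith) (mr_le x) (by linarith)
      have h2 : GG A U V r x ^ (2*δ) ≤ 1 + ∑ t ∈ TT d p r,
          (GG A U V r x ^ (-2 + 2 * (1/2:ℝ)^t.1) * (fn A U V t.2 x)^2) := by
        have e : GG A U V r x ^ (2*δ) = GG A U V r x ^ (-2 + 2*δ) * GG A U V r x ^ 2 := by
          rw [← rpow_natCast, ← rpow_add g0]; congr 1; push_cast; ring
        rw [e, GG_sq, mul_add, mul_one, Finset.mul_sum]
        have hδ1 : δ ≤ 1 := pow_le_one₀ (by norm_num) (by norm_num)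
        refine add_le_add (rpow_le_one_of_one_le_of_nonpos g1 (by linarith))
          (Finset.sum_le_sum fun t ht => ?_)
        simp only [TT, Finset.mem_sigma, Finset.mem_range] at ht
        refine mul_le_mul_of_nonneg_right (rpow_le_rpow_of_exponent_le g1 ?_) (sq_nonneg _)
        have : δ ≤ (1/2:ℝ)^t.1 :=
          pow_le_pow_of_le_one (by norm_num) (by norm_num) (by omega)
        linarith
      have P0 : 0 ≤ (1 + N) ^ (2*δ) := by positivity
      have h3 : mr A U V r x ^ (2*δ) ≤ (1 + N) ^ (2*δ) * (1 + ∑ t ∈ TT d p r,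
          (GG A U V r x ^ (-2 + 2 * (1/2:ℝ)^t.1) * (fn A U V t.2 x)^2)) :=
        h1.trans (mul_le_mul_of_nonneg_left h2 P0)
      have h4 := mul_le_mul_of_nonneg_right h3 (sq_nonneg ‖u x‖)
      refine h4.trans (le_of_eq ?_)
      simp only [← Finset.sum_mul]
      ring
  refine main.trans ?_
  rw [integral_const_mul, integral_add iu (integrable_finsetSum _ iL),
    integral_finsetSum _ iL, mul_assoc]
  have h5 : ∑ t ∈ TT d p r, ∫ x, (GG A U V r x ^ (-2 + 2 * (1/2:ℝ)^t.1)
      * (fn A U V t.2 x)^2) * ‖u x‖^2 ≤ ∑ t ∈ TT d p r, cst d M t.1 * EE A U V u := by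
    refine Finset.sum_le_sum fun t ht => ?_
    simp only [TT, Finset.mem_sigma, Finset.mem_range] at ht
    exact lev t.1 (by omega) t.2 ht.2
  rw [← Finset.sum_mul] at h5
  have h6 := u_le_EE (A := A) (U := U) (V := V) (u := u)
  have P0 : 0 ≤ (1 + N) ^ (2*δ) := by positivity
  refine mul_le_mul_of_nonneg_left ?_ P0
  rw [add_mul, one_mul]
  linarith

end
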